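/- arXiv:2110.04638 — 2 statements merged into one kernel-verified Lean document; each statement's English description precedes it below -/
import Mathlib

section
/- Let G be a symmetric finite discounted stochastic game and ε ≥ 0, and assume the set Δ^ε_eq of ε-equilibria of G is nonempty (which holds for every finite discounted stochastic game). Then G has the ε-revision paths property: for every joint policy γ_0 ∈ Δ there exists a finite ε-revision path γ_0, γ_1, …, γ_L such that γ_L ∈ Δ^ε_eq. -/
open scoped BigOperators

/-- A finite discounted stochastic game: finite player set `N`, finite state space `X`,
finite action sets `U i`, stage costs `c`, discount factors `β i ∈ [0,1)`, and a
transition kernel `P`. -/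
structure StochGame (N X : Type) (U : N → Type) [Fintype N] [DecidableEq N] [Fintype X]
    [∀ i, Fintype (U i)] : Type where
  c : N → X → (∀ j, U j) → ℝ
  β : N → ℝ
  β_nonneg : ∀ i, 0 ≤ β i
  β_lt_one : ∀ i, β i < 1
  P : X → (∀ j, U j) → X → ℝ
  P_nonneg : ∀ x a x', 0 ≤ P x a x'
  P_sum : ∀ x a, ∑ x', P x a x' = 1

/-- `γ` is a stationary policy: a stochastic kernel on actions given states. -/
def IsPol {X A : Type} [Fintype A] (γ : X → A → ℝ) : Prop :=
  (∀ x a, 0 ≤ γ x a) ∧ ∀ x, ∑ a, γ x a = 1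

section Game

variable {N X : Type} {U : N → Type} [Fintype N] [DecidableEq N] [Fintype X] [DecidableEq X]
  [∀ i, Fintype (U i)]

/-- A joint stationary policy: one stationary policy per player. -/
def IsJointPol (γ : ∀ i, X → U i → ℝ) : Prop := ∀ i, IsPol (γ i)

/-- Probability that joint action `a` is selected at state `x` (players randomize
independently). -/
def jointProb (γ : ∀ i, X → U i → ℝ) (x : X) (a : ∀ i, U i) : ℝ := ∏ i, γ i x (a i)

/-- Distribution of the state at time `t`, starting from `x0`, under joint policy `γ`. -/
noncomputable def stateDist (G : StochGame N X U) (γ : ∀ i, X → U i → ℝ) (x0 : X) :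
    ℕ → X → ℝ
  | 0, x => if x = x0 then 1 else 0
  | (t+1), x' => ∑ x, stateDist G γ x0 t x * ∑ a : ∀ i, U i, jointProb γ x a * G.P x a x'

/-- Expected stage cost of player `i` at time `t`, starting from `x0`, under `γ`. -/
noncomputable def expCost (G : StochGame N X U) (γ : ∀ i, X → U i → ℝ) (i : N) (x0 : X)
    (t : ℕ) : ℝ :=
  ∑ x, stateDist G γ x0 t x * ∑ a : ∀ j, U j, jointProb γ x a * G.c i x a

/-- `Jval G i x γ` is player `i`'s expected discounted cost from initial state `x`
under the joint stationary policy `γ`. -/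
noncomputable def Jval (G : StochGame N X U) (i : N) (x : X) (γ : ∀ j, X → U j → ℝ) : ℝ :=
  ∑' t : ℕ, (G.β i) ^ t * expCost G γ i x t

/-- `γ i` is an `ε`-best-response of player `i` to the policies `γ j`, `j ≠ i`, of the
remaining players. -/
def IsEpsBR (G : StochGame N X U) (ε : ℝ) (i : N) (γ : ∀ j, X → U j → ℝ) : Prop :=
  ∀ x, Jval G i x γ ≤
    (⨅ π : {f : X → U i → ℝ // IsPol f}, Jval G i x (Function.update γ i π.1)) + ε

/-- `γ` is an `ε`-equilibrium: every player is `ε`-best-responding. -/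
def IsEpsEq (G : StochGame N X U) (ε : ℝ) (γ : ∀ j, X → U j → ℝ) : Prop :=
  ∀ i, IsEpsBR G ε i γ

/-- `(path 0, …, path L)` is an `ε`-revision path: a player that is `ε`-best-responding
does not revise its policy at the next step. -/
def IsRevisionPath (G : StochGame N X U) (ε : ℝ) (L : ℕ)
    (path : ℕ → ∀ i, X → U i → ℝ) : Prop :=
  ∀ k < L, ∀ i, IsEpsBR G ε i (path k) → path (k+1) i = path k i

end Game

/-- A stochastic game with common action set `A` is symmetric: common discount factors,
and permuting the players' actions permutes the costs and leaves transitions unchanged. -/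
def IsSymmetricGame {N X A : Type} [Fintype N] [DecidableEq N] [Fintype X] [Fintype A]
    (G : StochGame N X (fun _ : N => A)) : Prop :=
  (∀ i j, G.β i = G.β j) ∧
  ∀ (σ : Equiv.Perm N) (i : N) (x : X) (a : N → A),
    G.c i x (fun j => a (σ j)) = G.c (σ i) x a ∧
    ∀ x', G.P x a x' = G.P x (fun j => a (σ j)) x'

theorem jointProb_comp_perm {N X A : Type} [Fintype N] (σ : Equiv.Perm N)
    (γ : N → X → A → ℝ) (x : X) (a : N → A) :
    jointProb (U := fun _ => A) (fun j => γ (σ j)) x (fun j => a (σ j)) =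
      jointProb (U := fun _ => A) γ x a :=
  Equiv.prod_comp σ fun j => γ j x (a j)

/-- Reindexing players in an expectation over joint actions. -/
theorem sum_jointProb_comp_perm {N X A : Type} [Fintype N] [DecidableEq N] [Fintype A]
    (σ : Equiv.Perm N) (γ : N → X → A → ℝ) (x : X) (f : (N → A) → ℝ) :
    ∑ a : N → A, jointProb (U := fun _ => A) (fun j => γ (σ j)) x a * f a =
      ∑ a : N → A, jointProb (U := fun _ => A) γ x a * f (fun j => a (σ j)) := by
  rw [← Equiv.sum_comp (σ.symm.arrowCongr (Equiv.refl A))]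
  refine Finset.sum_congr rfl fun a _ => ?_
  exact congrArg (· * f fun j => a (σ j)) (jointProb_comp_perm σ γ x a)

section Symmetry

variable {N X A : Type} [Fintype N] [DecidableEq N] [Fintype X] [DecidableEq X] [Fintype A]
  {G : StochGame N X (fun _ : N => A)}

theorem stateDist_comp_perm (hG : IsSymmetricGame G) (σ : Equiv.Perm N) (γ : N → X → A → ℝ)
    (x₀ : X) (t : ℕ) (x : X) :
    stateDist G (fun j => γ (σ j)) x₀ t x = stateDist G γ x₀ t x := by
  induction t generalizing x with
  | zero => rfl
  | succ t ih =>
    simp only [stateDist]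
    refine Finset.sum_congr rfl fun y _ => ?_
    rw [ih, sum_jointProb_comp_perm σ γ y fun a => G.P y a x]
    congr 1
    refine Finset.sum_congr rfl fun a _ => ?_
    by_cases h : Nonempty N
    · rw [← (hG.2 σ h.some y a).2 x]
    · have := not_nonempty_iff.mp h
      rw [Subsingleton.elim (fun j => a (σ j)) a]

theorem Jval_comp_perm (hG : IsSymmetricGame G) (σ : Equiv.Perm N) (γ : N → X → A → ℝ)
    (i : N) (x : X) :
    Jval G i x (fun j => γ (σ j)) = Jval G (σ i) x γ := by
  unfold Jval
  refine tsum_congr fun t => ?_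
  rw [hG.1 i (σ i)]
  congr 1
  unfold expCost
  refine Finset.sum_congr rfl fun y _ => ?_
  rw [stateDist_comp_perm hG, sum_jointProb_comp_perm σ γ y fun a => G.c i y a]
  simp only [(hG.2 σ i y _).1]

theorem isEpsBR_comp_perm (hG : IsSymmetricGame G) (ε : ℝ) (σ : Equiv.Perm N)
    (γ : N → X → A → ℝ) (i : N) :
    IsEpsBR G ε i (fun j => γ (σ j)) ↔ IsEpsBR G ε (σ i) γ := by
  have hupd (π : X → A → ℝ) : Function.update (fun j => γ (σ j)) i π =
      fun j => Function.update γ (σ i) π (σ j) := by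
    funext j
    simp [Function.update_apply]
  unfold IsEpsBR
  simp only [hupd, Jval_comp_perm hG]

/-- In a symmetric game, players using the same policy are either all `ε`-best-responding or
all not `ε`-best-responding. -/
theorem isEpsBR_iff_of_eq (hG : IsSymmetricGame G) (ε : ℝ) {γ : N → X → A → ℝ} {i j : N}
    (h : γ i = γ j) : IsEpsBR G ε i γ ↔ IsEpsBR G ε j γ := by
  have hswap : (fun k => γ (Equiv.swap i j k)) = γ := by
    funext k
    rw [Equiv.swap_apply_def]
    split_ifs with h₁ h₂
    · rw [h₁, h]
    · rw [h₂, h]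
    · rfl
  have := isEpsBR_comp_perm hG ε (Equiv.swap i j) γ i
  rwa [hswap, Equiv.swap_apply_left] at this

end Symmetry

section Path

variable {N X : Type} {U : N → Type} [Fintype N] [DecidableEq N] [Fintype X] [DecidableEq X]
  [∀ i, Fintype (U i)]

/-- Some finite `ε`-revision path through joint policies leads from `γ₀` to an
`ε`-equilibrium. -/
def ReachesEpsEq (G : StochGame N X U) (ε : ℝ) (γ₀ : ∀ i, X → U i → ℝ) : Prop :=
  ∃ (L : ℕ) (path : ℕ → ∀ i, X → U i → ℝ),
    path 0 = γ₀ ∧ (∀ k ≤ L, IsJointPol (path k)) ∧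
    IsRevisionPath G ε L path ∧ IsEpsEq G ε (path L)

theorem IsEpsEq.reachesEpsEq {G : StochGame N X U} {ε : ℝ} {γ : ∀ i, X → U i → ℝ}
    (h : IsEpsEq G ε γ) (hγ : IsJointPol γ) : ReachesEpsEq G ε γ :=
  ⟨0, fun _ => γ, rfl, fun _ _ => hγ, fun _ hk => absurd hk (Nat.not_lt_zero _), h⟩

theorem ReachesEpsEq.of_step {G : StochGame N X U} {ε : ℝ} {γ γ' : ∀ i, X → U i → ℝ}
    (h : ReachesEpsEq G ε γ') (hγ : IsJointPol γ)
    (hstep : ∀ i, IsEpsBR G ε i γ → γ' i = γ i) : ReachesEpsEq G ε γ := by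
  obtain ⟨L, path, rfl, hpol, hrev, heq⟩ := h
  refine ⟨L + 1, fun k => Nat.casesOn k γ path, rfl, ?_, ?_, heq⟩
  · rintro (_ | k) hk
    · exact hγ
    · exact hpol k (by omega)
  · rintro (_ | k) hk
    · exact hstep
    · exact hrev k (by omega)

end Path

/-- Theorem 3.1: a symmetric game with a nonempty set of
`ε`-equilibria has the `ε`-revision paths property: from any joint policy `γ0` there is
a finite `ε`-revision path ending at an `ε`-equilibrium. -/
theorem stmt1 {N X A : Type} [Fintype N] [DecidableEq N] [Fintype X] [DecidableEq X]
    [Fintype A]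
    (G : StochGame N X (fun _ : N => A)) (hG : IsSymmetricGame G)
    (ε : ℝ) (hε : 0 ≤ ε)
    (heq : ∃ γ : ∀ _ : N, X → A → ℝ, IsJointPol γ ∧ IsEpsEq G ε γ)
    (γ0 : ∀ _ : N, X → A → ℝ) (hγ0 : IsJointPol γ0) :
    ∃ (L : ℕ) (path : ℕ → ∀ _ : N, X → A → ℝ),
      path 0 = γ0 ∧ (∀ k ≤ L, IsJointPol (path k)) ∧
      IsRevisionPath G ε L path ∧ IsEpsEq G ε (path L) := by
  obtain ⟨γe, hγe, heqe⟩ := heq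
  change ReachesEpsEq G ε γ0
  induction hn : (Set.range γ0).ncard using Nat.strong_induction_on generalizing γ0 with
  | _ n ih =>
    by_cases h : IsEpsEq G ε γ0
    · exact h.reachesEpsEq hγ0
    obtain ⟨i, hi⟩ := not_forall.mp h
    by_cases hall : ∀ j, γ0 j = γ0 i
    · exact (heqe.reachesEpsEq hγe).of_step hγ0 fun j hj =>
        absurd ((isEpsBR_iff_of_eq hG ε (hall j)).mp hj) hi
    · obtain ⟨m, hm⟩ := not_forall.mp hall
      classical
      let γ' : N → X → A → ℝ := fun j => if γ0 j = γ0 i then γ0 m else γ0 j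
      have hpol : IsJointPol (U := fun _ : N => A) γ' := fun j => by
        by_cases hj : γ0 j = γ0 i
        · simpa only [γ', if_pos hj] using hγ0 m
        · simpa only [γ', if_neg hj] using hγ0 j
      have hlt : (Set.range γ').ncard < n := by
        rw [← hn]
        refine Set.ncard_lt_ncard ?_ (Set.finite_range γ0)
        refine (Set.ssubset_iff_of_subset ?_).mpr ⟨γ0 i, ⟨i, rfl⟩, ?_⟩
        · rintro _ ⟨j, rfl⟩
          by_cases hj : γ0 j = γ0 i
          · exact ⟨m, by simp only [γ', if_pos hj]⟩
          · exact ⟨j, by simp only [γ', if_neg hj]⟩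
        · rintro ⟨j, hj'⟩
          by_cases hj : γ0 j = γ0 i
          · exact hm (by simpa only [γ', if_pos hj] using hj')
          · exact hj (by simpa only [γ', if_neg hj] using hj')
      refine (ih _ hlt γ' hpol rfl).of_step hγ0 fun j hj => ?_
      exact if_neg fun hji => hi ((isEpsBR_iff_of_eq hG ε hji).mp hj)
end

section
/- For every finite discounted stochastic game and every ε > 0, there exists ξ = ξ(ε, G) > 0 with the following property: if Π = ∏_{i∈N} Π^i is any finite subset of Δ such that every joint policy γ ∈ Δ is within distance ξ of some element of Π (i.e. Π is a quantization of Δ into bins of radius at most ξ), then Π ∩ Δ^ε_eq ≠ ∅, i.e. Π contains an ε-equilibrium of the game. -/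
open scoped BigOperators

section QuantizedEquilibria

set_option linter.unusedSectionVars false

variable {N X : Type} {U : N → Type} [Fintype N] [DecidableEq N] [Fintype X] [DecidableEq X]
  [∀ i, Fintype (U i)]

theorem IsJointPol.update {γ : ∀ i, X → U i → ℝ} (h : IsJointPol γ) (i : N)
    {f : X → U i → ℝ} (hf : IsPol f) : IsJointPol (Function.update γ i f) := by
  intro j
  rcases eq_or_ne j i with rfl | hj
  · simpa using hf
  · simpa [hj] using h j

theorem isCompact_setOf_isJointPol :
    IsCompact {γ : ∀ i, X → U i → ℝ | IsJointPol γ} := by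
  refine (isCompact_Icc (a := (0 : ∀ i, X → U i → ℝ)) (b := 1)).of_isClosed_subset ?_ ?_
  · simp only [IsJointPol, IsPol, Set.ofPred_forall, Set.ofPred_and]
    refine isClosed_iInter fun i => IsClosed.inter ?_ ?_
    · exact isClosed_iInter fun x => isClosed_iInter fun a =>
        isClosed_le (by fun_prop) (by fun_prop)
    · exact isClosed_iInter fun x => isClosed_eq (by fun_prop) (by fun_prop)
  · intro γ hγ
    refine ⟨fun i x a => (hγ i).1 x a, fun i x a => ?_⟩
    rw [Pi.one_apply, Pi.one_apply, Pi.one_apply, ← (hγ i).2 x]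
    exact Finset.single_le_sum (f := fun b => γ i x b) (fun b _ => (hγ i).1 x b)
      (Finset.mem_univ a)

theorem jointProb_nonneg {γ : ∀ i, X → U i → ℝ} (h : IsJointPol γ) (x : X) (a : ∀ i, U i) :
    0 ≤ jointProb γ x a :=
  Finset.prod_nonneg fun i _ => (h i).1 x (a i)

theorem sum_jointProb {γ : ∀ i, X → U i → ℝ} (h : IsJointPol γ) (x : X) :
    ∑ a : ∀ i, U i, jointProb γ x a = 1 := by
  have := Finset.prod_univ_sum (fun i => (Finset.univ : Finset (U i))) (fun i b => γ i x b)
  rw [Fintype.piFinset_univ] at this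
  simp only [jointProb, ← this, (h _).2 x, Finset.prod_const_one]

theorem jointProb_le_one {γ : ∀ i, X → U i → ℝ} (h : IsJointPol γ) (x : X) (a : ∀ i, U i) :
    jointProb γ x a ≤ 1 :=
  (Finset.single_le_sum (fun b _ => jointProb_nonneg h x b) (Finset.mem_univ a)).trans_eq
    (sum_jointProb h x)

theorem stateDist_nonneg (G : StochGame N X U) {γ : ∀ i, X → U i → ℝ} (h : IsJointPol γ)
    (x₀ : X) (t : ℕ) (x : X) : 0 ≤ stateDist G γ x₀ t x := by
  induction t generalizing x with
  | zero => rw [stateDist]; split_ifs <;> norm_num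
  | succ t ih =>
    rw [stateDist]
    exact Finset.sum_nonneg fun y _ => mul_nonneg (ih y) <| Finset.sum_nonneg fun a _ =>
      mul_nonneg (jointProb_nonneg h y a) (G.P_nonneg y a x)

theorem sum_stateDist (G : StochGame N X U) {γ : ∀ i, X → U i → ℝ} (h : IsJointPol γ)
    (x₀ : X) (t : ℕ) : ∑ x, stateDist G γ x₀ t x = 1 := by
  induction t with
  | zero => simp [stateDist]
  | succ t ih =>
    simp only [stateDist]
    rw [Finset.sum_comm, ← ih]
    refine Finset.sum_congr rfl fun y _ => ?_
    rw [← Finset.mul_sum, Finset.sum_comm]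
    simp only [← Finset.mul_sum, G.P_sum, mul_one, sum_jointProb h]

theorem stateDist_le_one (G : StochGame N X U) {γ : ∀ i, X → U i → ℝ} (h : IsJointPol γ)
    (x₀ : X) (t : ℕ) (x : X) : stateDist G γ x₀ t x ≤ 1 :=
  (Finset.single_le_sum (fun y _ => stateDist_nonneg G h x₀ t y) (Finset.mem_univ x)).trans_eq
    (sum_stateDist G h x₀ t)

theorem abs_expCost_le (G : StochGame N X U) {γ : ∀ i, X → U i → ℝ} (h : IsJointPol γ)
    (i : N) (x₀ : X) (t : ℕ) : |expCost G γ i x₀ t| ≤ ∑ x, ∑ a, |G.c i x a| := by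
  refine (Finset.abs_sum_le_sum_abs _ _).trans (Finset.sum_le_sum fun x _ => ?_)
  rw [abs_mul, abs_of_nonneg (stateDist_nonneg G h x₀ t x)]
  refine (mul_le_of_le_one_left (abs_nonneg _) (stateDist_le_one G h x₀ t x)).trans ?_
  refine (Finset.abs_sum_le_sum_abs _ _).trans (Finset.sum_le_sum fun a _ => ?_)
  rw [abs_mul, abs_of_nonneg (jointProb_nonneg h x a)]
  exact mul_le_of_le_one_left (abs_nonneg _) (jointProb_le_one h x a)

theorem continuous_jointProb (x : X) (a : ∀ i, U i) :
    Continuous fun γ : ∀ i, X → U i → ℝ => jointProb γ x a := by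
  unfold jointProb
  fun_prop

theorem continuous_stateDist (G : StochGame N X U) (x₀ : X) (t : ℕ) (x : X) :
    Continuous fun γ : ∀ i, X → U i → ℝ => stateDist G γ x₀ t x := by
  induction t generalizing x with
  | zero => simpa only [stateDist] using continuous_const
  | succ t ih =>
    simp only [stateDist]
    exact continuous_finsetSum _ fun y _ => (ih y).mul <| continuous_finsetSum _ fun a _ =>
      (continuous_jointProb y a).mul continuous_const

theorem continuous_expCost (G : StochGame N X U) (i : N) (x₀ : X) (t : ℕ) :
    Continuous fun γ : ∀ i, X → U i → ℝ => expCost G γ i x₀ t :=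
  continuous_finsetSum _ fun y _ => (continuous_stateDist G x₀ t y).mul <|
    continuous_finsetSum _ fun a _ => (continuous_jointProb y a).mul continuous_const

theorem continuousOn_Jval (G : StochGame N X U) (i : N) (x : X) :
    ContinuousOn (Jval G i x) {γ | IsJointPol γ} := by
  refine continuousOn_tsum
    (u := fun t => G.β i ^ t * ∑ x, ∑ a, |G.c i x a|) (fun t => ?_) ?_ ?_
  · exact (continuous_const.mul (continuous_expCost G i x t)).continuousOn
  · exact (summable_geometric_of_lt_one (G.β_nonneg i) (G.β_lt_one i)).mul_right _
  · intro t γ hγ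
    rw [Real.norm_eq_abs, abs_mul, abs_of_nonneg (pow_nonneg (G.β_nonneg i) t)]
    exact mul_le_mul_of_nonneg_left (abs_expCost_le G hγ i x t) (pow_nonneg (G.β_nonneg i) t)

theorem bddBelow_range_Jval_update (G : StochGame N X U) {γ : ∀ j, X → U j → ℝ}
    (h : IsJointPol γ) (i : N) (x : X) :
    BddBelow (Set.range fun f : {f : X → U i → ℝ // IsPol f} =>
      Jval G i x (Function.update γ i f.1)) := by
  refine (isCompact_setOf_isJointPol.bddBelow_image (continuousOn_Jval G i x)).mono ?_
  rintro _ ⟨f, rfl⟩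
  exact ⟨_, h.update i f.2, rfl⟩

theorem exists_uniform_modulus_Jval (G : StochGame N X U) {ε : ℝ} (hε : 0 < ε) :
    ∃ δ > 0, ∀ γ, IsJointPol γ → ∀ π, IsJointPol π → dist γ π < δ →
      ∀ i x, |Jval G i x γ - Jval G i x π| < ε := by
  have huc : UniformContinuousOn (fun γ (i : N) (x : X) => Jval G i x γ)
      {γ | IsJointPol γ} :=
    isCompact_setOf_isJointPol.uniformContinuousOn_of_continuous <|
      continuousOn_pi.2 fun i => continuousOn_pi.2 fun x => continuousOn_Jval G i x
  obtain ⟨δ, hδ, h⟩ := Metric.uniformContinuousOn_iff.1 huc ε hε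
  refine ⟨δ, hδ, fun γ hγ π hπ hd i x => ?_⟩
  exact (dist_pi_lt_iff hε).1 ((dist_pi_lt_iff hε).1 (h γ hγ π hπ hd) i) x

theorem dist_update_le (γ π : ∀ j, X → U j → ℝ) (i : N) (f : X → U i → ℝ) :
    dist (Function.update γ i f) (Function.update π i f) ≤ dist γ π := by
  refine (dist_pi_le_iff dist_nonneg).2 fun j => ?_
  rcases eq_or_ne j i with rfl | hj
  · simp
  · simpa [hj] using dist_le_pi_dist γ π j

theorem IsEpsEq.of_close {G : StochGame N X U} {ε η δ : ℝ} {γ π : ∀ j, X → U j → ℝ}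
    (hγ : IsJointPol γ) (hπ : IsJointPol π) (heq : IsEpsEq G η γ)
    (hδ : ∀ γ, IsJointPol γ → ∀ π, IsJointPol π → dist γ π < δ →
      ∀ i x, |Jval G i x γ - Jval G i x π| < ε) (hd : dist γ π < δ) :
    IsEpsEq G (η + 2 * ε) π := by
  intro i x
  have : Nonempty {f : X → U i → ℝ // IsPol f} := ⟨⟨π i, hπ i⟩⟩
  have hinf : (⨅ f : {f : X → U i → ℝ // IsPol f}, Jval G i x (Function.update γ i f.1)) - ε ≤
      ⨅ f : {f : X → U i → ℝ // IsPol f}, Jval G i x (Function.update π i f.1) := by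
    refine le_ciInf fun f => ?_
    have h₁ := ciInf_le (bddBelow_range_Jval_update G hγ i x) f
    have h₂ := abs_lt.1 (hδ _ (hγ.update i f.2) _ (hπ.update i f.2)
      ((dist_update_le γ π i f.1).trans_lt hd) i x)
    linarith
  have h₁ := heq i x
  have h₂ := abs_lt.1 (hδ γ hγ π hπ hd i x)
  linarith

end QuantizedEquilibria

/-- Corollary 4.1: for every `ε > 0` there is `ξ > 0` such that every
finite product quantization `Π = ∏ᵢ Πᵢ` of `Δ` into bins of radius at most `ξ` (every
joint policy is within distance `ξ` of a member of `Π`) contains an `ε`-equilibrium.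
The existence of a `0`-equilibrium is taken as a hypothesis. -/
theorem stmt6 {N X : Type} {U : N → Type} [Fintype N] [DecidableEq N] [Fintype X]
    [DecidableEq X] [∀ i, Fintype (U i)]
    (G : StochGame N X U)
    (heq0 : ∃ γ : ∀ j, X → U j → ℝ, IsJointPol γ ∧ IsEpsEq G 0 γ)
    (ε : ℝ) (hε : 0 < ε) :
    ∃ ξ > (0 : ℝ), ∀ Pis : ∀ i, Set (X → U i → ℝ),
      (∀ i, (Pis i).Finite) → (∀ i, ∀ f ∈ Pis i, IsPol f) →
      (∀ γ : ∀ j, X → U j → ℝ, IsJointPol γ →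
        ∃ π : ∀ j, X → U j → ℝ, (∀ i, π i ∈ Pis i) ∧
          ∀ (i : N) (s : X) (a : U i), |γ i s a - π i s a| ≤ ξ) →
      ∃ π : ∀ j, X → U j → ℝ, (∀ i, π i ∈ Pis i) ∧ IsEpsEq G ε π := by
  obtain ⟨γ, hγ, heq⟩ := heq0
  obtain ⟨δ, hδ, hmod⟩ := exists_uniform_modulus_Jval G (half_pos hε)
  refine ⟨δ / 2, half_pos hδ, fun Pis _ hpol hcover => ?_⟩
  obtain ⟨π, hπ, hclose⟩ := hcover γ hγ
  have hd : dist γ π < δ := by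
    refine lt_of_le_of_lt ?_ (half_lt_self hδ)
    simp only [dist_pi_le_iff (half_pos hδ).le, Real.dist_eq]
    exact hclose
  refine ⟨π, hπ, ?_⟩
  have := heq.of_close hγ (fun i => hpol i _ (hπ i)) hmod hd
  rwa [zero_add, mul_div_cancel₀ ε two_ne_zero] at this
end
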